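/- arXiv:1207.3246 — 2 statements merged into one kernel-verified Lean document; each statement's English description precedes it below -/
import Mathlib

section
/- Let r ∈ (0,1] be a point at which all entries of G₁ and G₂ are continuous. Then lim_{T→∞} E[ v_{[Tr]} v_{[Tr]}ᵀ ] = (G₂(r) ⊗ G₁(r)) M (G₂(r) ⊗ G₁(r))ᵀ − vec(Σ¹²(r)) vec(Σ¹²(r))ᵀ. -/
open MeasureTheory ProbabilityTheory Matrix Filter
open scoped Kronecker NNReal Topology

noncomputable section

/-- A function satisfies a Lipschitz condition piecewise on a finite number of
sub-intervals partitioning `(0,1]`. -/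
def PiecewiseLipschitz (f : ℝ → ℝ) : Prop :=
  ∃ (n : ℕ) (a : Fin (n + 1) → ℝ), a 0 = 0 ∧ a (Fin.last n) = 1 ∧ StrictMono a ∧
    ∀ i : Fin n, ∃ K : ℝ≥0, LipschitzOnWith K f (Set.Ioc (a i.castSucc) (a i.succ))

/-- Euclidean norm of a finitely indexed real vector. -/
def euclNorm {ι : Type*} [Fintype ι] (x : ι → ℝ) : ℝ := Real.sqrt (∑ i, x i ^ 2)

/-- `v_{T,t} = u_{2t} ⊗ u_{1t} − vec(Σ¹²(t/T))`, where `u_{1t} = G₁(t/T) ε_t`,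
`u_{2t} = G₂(t/T) ε_t` and `vec` is column vectorization (index `(i,j) ↦ A j i`). -/
def vSeq {d₁ d₂ : ℕ} (G₁ : ℝ → Matrix (Fin d₁) (Fin (d₁ + d₂)) ℝ)
    (G₂ : ℝ → Matrix (Fin d₂) (Fin (d₁ + d₂)) ℝ) {Ω' : Type*}
    (ε : ℕ → Ω' → Fin (d₁ + d₂) → ℝ) (T t : ℕ) (ω : Ω') : Fin d₂ × Fin d₁ → ℝ :=
  fun p =>
    (G₂ ((t : ℝ) / T)).mulVec (ε t ω) p.1 * (G₁ ((t : ℝ) / T)).mulVec (ε t ω) p.2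
      - (G₁ ((t : ℝ) / T) * (G₂ ((t : ℝ) / T))ᵀ) p.2 p.1

theorem aux_abs_le {ι : Type*} [Fintype ι] (x : ι → ℝ) (i : ι) : |x i| ≤ euclNorm x := by
  unfold euclNorm
  apply Real.le_sqrt_of_sq_le
  rw [sq_abs]
  exact Finset.single_le_sum (f := fun i => x i ^ 2) (fun j _ => sq_nonneg _) (Finset.mem_univ i)

theorem aux_moment {n m₁ m₂ : ℕ} (A : Matrix (Fin m₁) (Fin n) ℝ) (B : Matrix (Fin m₂) (Fin n) ℝ)
    {Ω' : Type*} [MeasurableSpace Ω'] (P : Measure Ω') [IsProbabilityMeasure P]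
    (e : Ω' → Fin n → ℝ) (hmeas : Measurable e)
    (hmom : Integrable (fun ω => euclNorm (e ω) ^ 4) P)
    (hcov : ∀ i j, ∫ ω, e ω i * e ω j ∂P = if i = j then 1 else 0)
    (M : Matrix (Fin n × Fin n) (Fin n × Fin n) ℝ)
    (hM : ∀ p q : Fin n × Fin n,
      ∫ ω, e ω p.1 * e ω q.1 * (e ω p.2 * e ω q.2) ∂P = M p q) (p q : Fin m₂ × Fin m₁) :
    ∫ ω, (B.mulVec (e ω) p.1 * A.mulVec (e ω) p.2 - (A * Bᵀ) p.2 p.1) *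
      (B.mulVec (e ω) q.1 * A.mulVec (e ω) q.2 - (A * Bᵀ) q.2 q.1) ∂P =
    ((B ⊗ₖ A) * M * (B ⊗ₖ A)ᵀ) p q - (A * Bᵀ) p.2 p.1 * (A * Bᵀ) q.2 q.1 := by
  have hc : ∀ i, Measurable (fun ω => e ω i) := fun i => (measurable_pi_apply i).comp hmeas
  have hn : ∀ ω, 0 ≤ euclNorm (e ω) := fun ω => Real.sqrt_nonneg _
  have h4 : ∀ k l : Fin n × Fin n,
      Integrable (fun ω => (e ω k.1 * e ω k.2) * (e ω l.1 * e ω l.2)) P := by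
    intro k l
    refine hmom.mono' (((hc _).mul (hc _)).mul ((hc _).mul (hc _))).aestronglyMeasurable ?_
    refine Eventually.of_forall fun ω => ?_
    have h := aux_abs_le (e ω)
    have := hn ω
    calc ‖(e ω k.1 * e ω k.2) * (e ω l.1 * e ω l.2)‖
        = (|e ω k.1| * |e ω k.2|) * (|e ω l.1| * |e ω l.2|) := by
          simp only [Real.norm_eq_abs, abs_mul]
      _ ≤ (euclNorm (e ω) * euclNorm (e ω)) * (euclNorm (e ω) * euclNorm (e ω)) := by
          gcongr <;> exact h _
      _ = _ := by ring
  have h2 : ∀ k : Fin n × Fin n, Integrable (fun ω => e ω k.1 * e ω k.2) P := by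
    intro k
    refine ((integrable_const (1 : ℝ)).add hmom).mono' ((hc _).mul (hc _)).aestronglyMeasurable ?_
    refine Eventually.of_forall fun ω => ?_
    have h := aux_abs_le (e ω)
    have := hn ω
    calc ‖e ω k.1 * e ω k.2‖ = |e ω k.1| * |e ω k.2| := by
          simp only [Real.norm_eq_abs, abs_mul]
      _ ≤ euclNorm (e ω) * euclNorm (e ω) := by
          gcongr <;> exact h _
      _ ≤ 1 + euclNorm (e ω) ^ 4 := by nlinarith [sq_nonneg (euclNorm (e ω) ^ 2 - 1), sq_nonneg (euclNorm (e ω))]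
  have hX : ∀ (p : Fin m₂ × Fin m₁) ω, B.mulVec (e ω) p.1 * A.mulVec (e ω) p.2
      = ∑ k : Fin n × Fin n, (B ⊗ₖ A) p k * (e ω k.1 * e ω k.2) := by
    intro p ω
    simp only [Matrix.mulVec, dotProduct, Fintype.sum_prod_type, Finset.sum_mul_sum,
      Matrix.kroneckerMap_apply]
    refine Finset.sum_congr rfl fun i _ => Finset.sum_congr rfl fun j _ => ?_
    ring
  have iX : ∀ p : Fin m₂ × Fin m₁,
      Integrable (fun ω => B.mulVec (e ω) p.1 * A.mulVec (e ω) p.2) P := by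
    intro p
    simp only [hX]
    exact integrable_finsetSum _ fun k _ => (h2 k).const_mul _
  have EX : ∀ p : Fin m₂ × Fin m₁,
      ∫ ω, B.mulVec (e ω) p.1 * A.mulVec (e ω) p.2 ∂P = (A * Bᵀ) p.2 p.1 := by
    intro p
    simp only [hX]
    rw [integral_finsetSum _ fun k _ => (h2 k).const_mul _]
    simp only [integral_const_mul, hcov, Fintype.sum_prod_type, Matrix.kroneckerMap_apply,
      Matrix.mul_apply, Matrix.transpose_apply]
    refine Finset.sum_congr rfl fun i _ => ?_
    simp [mul_comm]
  have hXX : ∀ ω, (B.mulVec (e ω) p.1 * A.mulVec (e ω) p.2) *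
      (B.mulVec (e ω) q.1 * A.mulVec (e ω) q.2) =
      ∑ l : Fin n × Fin n, ∑ k : Fin n × Fin n, ((B ⊗ₖ A) p k * (B ⊗ₖ A) q l) *
        ((e ω k.1 * e ω k.2) * (e ω l.1 * e ω l.2)) := by
    intro ω
    rw [hX, hX, Finset.sum_mul_sum, Finset.sum_comm]
    refine Finset.sum_congr rfl fun i _ => Finset.sum_congr rfl fun j _ => ?_
    ring
  have iXX : Integrable (fun ω => (B.mulVec (e ω) p.1 * A.mulVec (e ω) p.2) *
      (B.mulVec (e ω) q.1 * A.mulVec (e ω) q.2)) P := by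
    simp only [hXX]
    exact integrable_finsetSum _ fun l _ => integrable_finsetSum _ fun k _ => (h4 k l).const_mul _
  have EXX : ∫ ω, (B.mulVec (e ω) p.1 * A.mulVec (e ω) p.2) *
      (B.mulVec (e ω) q.1 * A.mulVec (e ω) q.2) ∂P = ((B ⊗ₖ A) * M * (B ⊗ₖ A)ᵀ) p q := by
    simp only [hXX]
    rw [integral_finsetSum _ fun l _ => integrable_finsetSum _ fun k _ => (h4 k l).const_mul _]
    rw [Matrix.mul_apply]
    refine Finset.sum_congr rfl fun l _ => ?_
    rw [integral_finsetSum _ fun k _ => (h4 k l).const_mul _, Matrix.mul_apply, Finset.sum_mul]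
    refine Finset.sum_congr rfl fun k _ => ?_
    rw [integral_const_mul, ← hM k l, Matrix.transpose_apply]
    have : ∀ ω, (e ω k.1 * e ω k.2) * (e ω l.1 * e ω l.2)
      = e ω k.1 * e ω l.1 * (e ω k.2 * e ω l.2) := fun ω => by ring
    simp only [this]
    ring
  have Ep := EX p
  have Eq' := EX q
  have ip := iX p
  have iq := iX q
  generalize (A * Bᵀ) p.2 p.1 = a at *
  generalize (A * Bᵀ) q.2 q.1 = b at *
  have : ∀ ω, (B.mulVec (e ω) p.1 * A.mulVec (e ω) p.2 - a) *
      (B.mulVec (e ω) q.1 * A.mulVec (e ω) q.2 - b) =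
      ((B.mulVec (e ω) p.1 * A.mulVec (e ω) p.2) * (B.mulVec (e ω) q.1 * A.mulVec (e ω) q.2)
        - b * (B.mulVec (e ω) p.1 * A.mulVec (e ω) p.2))
        - (a * (B.mulVec (e ω) q.1 * A.mulVec (e ω) q.2) - a * b) := fun ω => by ring
  simp only [this]
  have j1 : Integrable (fun ω => (B.mulVec (e ω) p.1 * A.mulVec (e ω) p.2) *
      (B.mulVec (e ω) q.1 * A.mulVec (e ω) q.2)
        - b * (B.mulVec (e ω) p.1 * A.mulVec (e ω) p.2)) P := iXX.sub (ip.const_mul b)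
  have j2 : Integrable (fun ω => a * (B.mulVec (e ω) q.1 * A.mulVec (e ω) q.2) - a * b) P :=
    (iq.const_mul a).sub (integrable_const _)
  rw [integral_sub j1 j2,
    integral_sub iXX (ip.const_mul b), integral_sub (iq.const_mul a) (integrable_const _),
    integral_const_mul, integral_const_mul, EXX, Ep, Eq']
  simp
  ring

theorem statement0
    (d₁ d₂ : ℕ) (hd₁ : 1 ≤ d₁) (hd₂ : 1 ≤ d₂)
    (G₁ : ℝ → Matrix (Fin d₁) (Fin (d₁ + d₂)) ℝ)
    (G₂ : ℝ → Matrix (Fin d₂) (Fin (d₁ + d₂)) ℝ)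
    (hG₁bdd : ∃ C : ℝ, ∀ r ∈ Set.Ioc (0 : ℝ) 1, ∀ i j, |G₁ r i j| ≤ C)
    (hG₂bdd : ∃ C : ℝ, ∀ r ∈ Set.Ioc (0 : ℝ) 1, ∀ i j, |G₂ r i j| ≤ C)
    (hG₁lip : ∀ i j, PiecewiseLipschitz fun r => G₁ r i j)
    (hG₂lip : ∀ i j, PiecewiseLipschitz fun r => G₂ r i j)
    {Ω' : Type*} [MeasurableSpace Ω'] (P : Measure Ω') [IsProbabilityMeasure P]
    (ε : ℕ → Ω' → Fin (d₁ + d₂) → ℝ)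
    (hmeas : ∀ t, Measurable (ε t))
    (hmom : ∀ t, Integrable (fun ω => euclNorm (ε t ω) ^ 4) P)
    (hcov : ∀ t, ∀ i j, ∫ ω, ε t ω i * ε t ω j ∂P = if i = j then 1 else 0)
    (M : Matrix (Fin (d₁ + d₂) × Fin (d₁ + d₂)) (Fin (d₁ + d₂) × Fin (d₁ + d₂)) ℝ)
    (hM : ∀ t, ∀ p q : Fin (d₁ + d₂) × Fin (d₁ + d₂),
      ∫ ω, ε t ω p.1 * ε t ω q.1 * (ε t ω p.2 * ε t ω q.2) ∂P = M p q)
    (r : ℝ) (hr : r ∈ Set.Ioc (0 : ℝ) 1)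
    (hcont₁ : ∀ i j, ContinuousWithinAt (fun s => G₁ s i j) (Set.Ioc (0 : ℝ) 1) r)
    (hcont₂ : ∀ i j, ContinuousWithinAt (fun s => G₂ s i j) (Set.Ioc (0 : ℝ) 1) r) :
    Tendsto
      (fun T : ℕ => fun p q : Fin d₂ × Fin d₁ =>
        ∫ ω, vSeq G₁ G₂ ε T ⌊(T : ℝ) * r⌋₊ ω p * vSeq G₁ G₂ ε T ⌊(T : ℝ) * r⌋₊ ω q ∂P)
      atTop
      (𝓝 (fun p q : Fin d₂ × Fin d₁ =>
        ((G₂ r ⊗ₖ G₁ r) * M * (G₂ r ⊗ₖ G₁ r)ᵀ) p q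
          - (G₁ r * (G₂ r)ᵀ) p.2 p.1 * (G₁ r * (G₂ r)ᵀ) q.2 q.1)) := by
  have hlim : Tendsto (fun T : ℕ => ((⌊(T : ℝ) * r⌋₊ : ℕ) : ℝ) / (T : ℝ)) atTop
      (𝓝[Set.Ioc (0 : ℝ) 1] r) := by
    refine tendsto_nhdsWithin_iff.2 ⟨?_, ?_⟩
    · have h := (tendsto_nat_floor_mul_div_atTop (R := ℝ) hr.1.le).comp
        (tendsto_natCast_atTop_atTop (R := ℝ))
      refine h.congr fun T => ?_
      simp [mul_comm]
    · have h1 : Tendsto (fun T : ℕ => (T : ℝ) * r) atTop atTop :=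
        (tendsto_natCast_atTop_atTop).atTop_mul_const hr.1
      filter_upwards [h1.eventually_ge_atTop 1, eventually_gt_atTop 0] with T hT hT0
      have hT0' : (0 : ℝ) < T := by exact_mod_cast hT0
      have hf : 0 < ⌊(T : ℝ) * r⌋₊ := Nat.floor_pos.2 hT
      refine ⟨div_pos (by exact_mod_cast hf) hT0', ?_⟩
      rw [div_le_one hT0']
      have := Nat.floor_le (zero_le_one.trans hT)
      nlinarith [hr.2]
  have l1 : ∀ i j, Tendsto (fun T : ℕ => G₁ (((⌊(T : ℝ) * r⌋₊ : ℕ) : ℝ) / (T : ℝ)) i j) atTop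
      (𝓝 (G₁ r i j)) := fun i j => (hcont₁ i j).tendsto.comp hlim
  have l2 : ∀ i j, Tendsto (fun T : ℕ => G₂ (((⌊(T : ℝ) * r⌋₊ : ℕ) : ℝ) / (T : ℝ)) i j) atTop
      (𝓝 (G₂ r i j)) := fun i j => (hcont₂ i j).tendsto.comp hlim
  have m1 : Tendsto (fun T : ℕ => G₁ (((⌊(T : ℝ) * r⌋₊ : ℕ) : ℝ) / (T : ℝ))) atTop
      (𝓝 (G₁ r)) := tendsto_pi_nhds.2 fun i => tendsto_pi_nhds.2 fun j => l1 i j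
  have m2 : Tendsto (fun T : ℕ => G₂ (((⌊(T : ℝ) * r⌋₊ : ℕ) : ℝ) / (T : ℝ))) atTop
      (𝓝 (G₂ r)) := tendsto_pi_nhds.2 fun i => tendsto_pi_nhds.2 fun j => l2 i j
  refine tendsto_pi_nhds.2 fun p => tendsto_pi_nhds.2 fun q => ?_
  have key : Continuous (fun x : Matrix (Fin d₁) (Fin (d₁ + d₂)) ℝ ×
      Matrix (Fin d₂) (Fin (d₁ + d₂)) ℝ =>
      ((x.2 ⊗ₖ x.1) * M * (x.2 ⊗ₖ x.1)ᵀ) p q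
        - (x.1 * (x.2)ᵀ) p.2 p.1 * (x.1 * (x.2)ᵀ) q.2 q.1) := by
    simp only [Matrix.mul_apply, Matrix.transpose_apply, Matrix.kroneckerMap_apply]
    fun_prop
  refine ((key.tendsto (G₁ r, G₂ r)).comp (m1.prodMk_nhds m2)).congr fun T => ?_
  exact (aux_moment _ _ P (ε _) (hmeas _) (hmom _) (hcov _) M (hM _) p q).symm

end
end

section
/- As T → ∞, the random vector T^{−1} Σ_{t=1}^{T} ϑ_t converges in probability to ∫₀¹ vec(Σ¹²(r)) dr. -/
open MeasureTheory ProbabilityTheory Matrix Filter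
open scoped Kronecker NNReal Topology

noncomputable section

/-- `ϑ_{T,t} = u_{2t} ⊗ u_{1t}` where `u_{1t} = G₁(t/T) ε_t`, `u_{2t} = G₂(t/T) ε_t`. -/
def thetaSeq {d₁ d₂ : ℕ} (G₁ : ℝ → Matrix (Fin d₁) (Fin (d₁ + d₂)) ℝ)
    (G₂ : ℝ → Matrix (Fin d₂) (Fin (d₁ + d₂)) ℝ) {Ω' : Type*}
    (ε : ℕ → Ω' → Fin (d₁ + d₂) → ℝ) (T t : ℕ) (ω : Ω') : Fin d₂ × Fin d₁ → ℝ :=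
  fun p =>
    (G₂ ((t : ℝ) / T)).mulVec (ε t ω) p.1 * (G₁ ((t : ℝ) / T)).mulVec (ε t ω) p.2

lemma pl_ae_cont {f : ℝ → ℝ} (hf : PiecewiseLipschitz f) :
    ∀ᵐ r ∂(volume.restrict (Set.Ioc (0 : ℝ) 1)), ContinuousAt f r := by
  obtain ⟨n, a, h0, h1, hmono, hL⟩ := hf
  rw [ae_restrict_iff' measurableSet_Ioc]
  have hfin : ∀ᵐ r ∂(volume : Measure ℝ), r ∉ Set.range a := by
    have := (Set.finite_range a).measure_zero (volume : Measure ℝ)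
    exact measure_eq_zero_iff_ae_notMem.mp this
  filter_upwards [hfin] with r hr hr01
  by_contra hc
  have key : ∀ i : Fin (n + 1), a i < r := by
    intro i
    induction i using Fin.induction with
    | zero => rw [h0]; exact hr01.1
    | succ i ih =>
      by_contra hlt
      have hne : a i.succ ≠ r := fun h => hr ⟨_, h⟩
      have hlt' : r < a i.succ := lt_of_le_of_ne (not_lt.mp hlt) (Ne.symm hne)
      obtain ⟨K, hK⟩ := hL i
      exact hc (hK.continuousOn.continuousAt (Ioc_mem_nhds ih hlt'))
  have := key (Fin.last n)
  rw [h1] at this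
  exact absurd hr01.2 (not_le.mpr this)

lemma riemann_tendsto {g : ℝ → ℝ} {C : ℝ} (hb : ∀ r ∈ Set.Ioc (0 : ℝ) 1, |g r| ≤ C)
    (hc : ∀ᵐ r ∂(volume.restrict (Set.Ioc (0 : ℝ) 1)), ContinuousAt g r) :
    Tendsto (fun T : ℕ => (T : ℝ)⁻¹ * ∑ t ∈ Finset.Icc 1 T, g ((t : ℝ) / T)) atTop
      (𝓝 (∫ r in Set.Ioc (0 : ℝ) 1, g r)) := by
  let h : ℕ → ℝ → ℝ := fun T r => g ((⌈r * T⌉ : ℤ) / (T : ℝ))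
  have hmeas : ∀ T, Measurable (h T) := by
    intro T
    have h1 : Measurable (fun z : ℤ => g ((z : ℝ) / (T : ℝ))) := measurable_from_top
    have h2 : Measurable (fun r : ℝ => ⌈r * T⌉) := Int.measurable_ceil.comp (by fun_prop)
    exact h1.comp h2
  have hbd : ∀ T : ℕ, 0 < T → ∀ r ∈ Set.Ioc (0 : ℝ) 1, ‖h T r‖ ≤ C := by
    intro T hT r hr
    have hT' : (0 : ℝ) < T := by exact_mod_cast hT
    apply hb
    constructor
    · apply div_pos _ hT'
      have : 0 < ⌈r * T⌉ := Int.ceil_pos.mpr (mul_pos hr.1 hT')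
      exact_mod_cast this
    · rw [div_le_one hT']
      have : ⌈r * T⌉ ≤ (T : ℤ) := by
        rw [Int.ceil_le]
        push_cast
        nlinarith [hr.2]
      exact_mod_cast this
  have hlim : Tendsto (fun T => ∫ r in Set.Ioc (0 : ℝ) 1, h T r) atTop
      (𝓝 (∫ r in Set.Ioc (0 : ℝ) 1, g r)) := by
    refine tendsto_integral_filter_of_dominated_convergence (fun _ => C) ?_ ?_ ?_ ?_
    · exact Eventually.of_forall fun T => (hmeas T).aestronglyMeasurable
    · filter_upwards [eventually_gt_atTop 0] with T hT
      exact (ae_restrict_iff' measurableSet_Ioc).mpr (Eventually.of_forall fun r hr => hbd T hT r hr)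
    · exact integrable_const C
    · filter_upwards [hc] with r hr
      refine hr.tendsto.comp ?_
      have hi : Tendsto (fun T : ℕ => r + (T : ℝ)⁻¹) atTop (𝓝 (r + 0)) :=
        tendsto_const_nhds.add tendsto_inv_atTop_nhds_zero_nat
      rw [add_zero] at hi
      refine tendsto_of_tendsto_of_tendsto_of_le_of_le' tendsto_const_nhds hi ?_ ?_
      · filter_upwards [eventually_gt_atTop 0] with T hT
        have hT' : (0 : ℝ) < T := by exact_mod_cast hT
        rw [le_div_iff₀ hT']
        exact Int.le_ceil _
      · filter_upwards [eventually_gt_atTop 0] with T hT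
        have hT' : (0 : ℝ) < T := by exact_mod_cast hT
        rw [div_le_iff₀ hT', add_mul, inv_mul_cancel₀ hT'.ne']
        exact (Int.ceil_lt_add_one _).le
  refine hlim.congr' ?_
  filter_upwards [eventually_gt_atTop 0] with T hT
  have hT' : (0 : ℝ) < T := by exact_mod_cast hT
  have hint : IntervalIntegrable (h T) volume 0 1 := by
    rw [intervalIntegrable_iff_integrableOn_Ioc_of_le zero_le_one]
    refine Integrable.mono' (integrable_const C) (hmeas T).aestronglyMeasurable ?_
    exact (ae_restrict_iff' measurableSet_Ioc).mpr (Eventually.of_forall fun r hr => hbd T hT r hr)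
  rw [← intervalIntegral.integral_of_le zero_le_one]
  have hs := intervalIntegral.sum_integral_adjacent_intervals (f := h T) (μ := volume)
    (a := fun k : ℕ => (k : ℝ) / T) (n := T) (by
      intro k hk
      have hk' : ((k + 1 : ℕ) : ℝ) ≤ T := by exact_mod_cast hk
      refine hint.mono_set ?_
      rw [Set.uIcc_of_le zero_le_one, Set.uIcc_of_le (by gcongr; simp)]
      apply Set.Icc_subset_Icc
      · positivity
      · rw [div_le_one hT']; exact hk')
  simp only [Nat.cast_zero, zero_div, div_self hT'.ne'] at hs
  rw [← hs, Finset.mul_sum, Finset.range_eq_Ico, Finset.sum_Ico_eq_sum_range,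
    ← Finset.Ico_add_one_right_eq_Icc, Finset.sum_Ico_eq_sum_range]
  simp only [Nat.sub_zero, Nat.add_sub_cancel, zero_add]
  refine Finset.sum_congr rfl fun k _ => ?_
  have hle : (k : ℝ) / T ≤ ((k + 1 : ℕ) : ℝ) / T := by gcongr; simp
  rw [intervalIntegral.integral_congr_Ioo_of_le (g := fun _ => g (((1 + k : ℕ) : ℝ) / T)) hle]
  · rw [intervalIntegral.integral_const, smul_eq_mul]
    congr 1
    push_cast
    field_simp
    ring
  · intro r hr
    simp only [h]
    have : ⌈r * T⌉ = (k + 1 : ℤ) := by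
      rw [Int.ceil_eq_iff]
      have h1 := hr.1
      have h2 := hr.2
      rw [div_lt_iff₀ hT'] at h1
      rw [lt_div_iff₀ hT'] at h2
      push_cast at *
      constructor <;> linarith
    rw [this]
    push_cast
    rw [add_comm]

lemma orth_tendsto {Ω' : Type*} {mΩ : MeasurableSpace Ω'} (P : Measure Ω') [IsProbabilityMeasure P]
    (η : ℕ → Ω' → ℝ) (C K : ℝ) (w : ℕ → ℕ → ℝ)
    (hL : ∀ t, 1 ≤ t → MemLp (η t) 2 P)
    (horth : ∀ s t, 1 ≤ s → s < t → ∫ ω, η s ω * η t ω ∂P = 0)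
    (hC : ∀ t, 1 ≤ t → ∫ ω, η t ω ^ 2 ∂P ≤ C)
    (hw : ∀ T t, 1 ≤ t → t ≤ T → |w T t| ≤ K) :
    Tendsto (fun T : ℕ => ∫ ω, |(T : ℝ)⁻¹ * ∑ t ∈ Finset.Icc 1 T, w T t * η t ω| ∂P) atTop (𝓝 0) := by
  let Z : ℕ → Ω' → ℝ := fun T ω => (T : ℝ)⁻¹ * ∑ t ∈ Finset.Icc 1 T, w T t * η t ω
  have hZ : ∀ T, MemLp (Z T) 2 P := by
    intro T
    have h1 : MemLp (fun ω => ∑ t ∈ Finset.Icc 1 T, w T t * η t ω) 2 P :=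
      memLp_finsetSum (Finset.Icc 1 T) (f := fun t ω => w T t * η t ω) fun t ht =>
        (hL t (Finset.mem_Icc.mp ht).1).const_mul (w T t)
    exact h1.const_mul ((T : ℝ)⁻¹)
  have hC0 : 0 ≤ C := (integral_nonneg fun ω => sq_nonneg (η 1 ω)).trans (hC 1 le_rfl)
  have hZ2 : ∀ T : ℕ, 0 < T → ∫ ω, Z T ω ^ 2 ∂P ≤ K ^ 2 * C * (T : ℝ)⁻¹ := by
    intro T hT
    have hT' : (0 : ℝ) < T := by exact_mod_cast hT
    have e1 : ∀ ω, Z T ω ^ 2 = (T : ℝ)⁻¹ ^ 2 * ∑ s ∈ Finset.Icc 1 T, ∑ t ∈ Finset.Icc 1 T,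
        (w T s * w T t) * (η s ω * η t ω) := by
      intro ω
      simp only [Z]
      rw [mul_pow, pow_two (∑ t ∈ Finset.Icc 1 T, w T t * η t ω), Finset.sum_mul_sum]
      congr 1
      refine Finset.sum_congr rfl fun s _ => Finset.sum_congr rfl fun t _ => by ring
    have hint : ∀ s ∈ Finset.Icc 1 T, ∀ t ∈ Finset.Icc 1 T,
        Integrable (fun ω => (w T s * w T t) * (η s ω * η t ω)) P := by
      intro s hs t ht
      exact ((hL s (Finset.mem_Icc.mp hs).1).integrable_mul
        (hL t (Finset.mem_Icc.mp ht).1)).const_mul _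
    simp_rw [e1]
    rw [integral_const_mul, integral_finsetSum _ (fun s hs => integrable_finsetSum _ (hint s hs))]
    have e2 : ∀ s ∈ Finset.Icc 1 T, ∫ ω, ∑ t ∈ Finset.Icc 1 T,
        (w T s * w T t) * (η s ω * η t ω) ∂P ≤ K ^ 2 * C := by
      intro s hs
      have hs1 := (Finset.mem_Icc.mp hs).1
      rw [integral_finsetSum _ (hint s hs), Finset.sum_eq_single_of_mem s hs]
      · rw [integral_const_mul]
        have hsq : ∫ ω, η s ω * η s ω ∂P ≤ C := by
          simpa only [pow_two] using hC s hs1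
        have hww : w T s * w T s ≤ K ^ 2 := by
          have := hw T s hs1 (Finset.mem_Icc.mp hs).2
          rw [← abs_mul_abs_self, pow_two]
          exact mul_self_le_mul_self (abs_nonneg _) this
        calc _ ≤ (w T s * w T s) * C := mul_le_mul_of_nonneg_left hsq (mul_self_nonneg _)
          _ ≤ _ := mul_le_mul_of_nonneg_right hww hC0
      · intro t ht hts
        rw [integral_const_mul]
        rcases lt_or_gt_of_ne hts with h | h
        · have := horth t s (Finset.mem_Icc.mp ht).1 h
          simp_rw [mul_comm (η s _)]
          rw [this, mul_zero]
        · rw [horth s t hs1 h, mul_zero]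
    calc _ ≤ (T : ℝ)⁻¹ ^ 2 * ∑ s ∈ Finset.Icc 1 T, K ^ 2 * C :=
          mul_le_mul_of_nonneg_left (Finset.sum_le_sum e2) (by positivity)
      _ = _ := by
        rw [Finset.sum_const, Nat.card_Icc, nsmul_eq_mul]
        simp only [Nat.add_sub_cancel]
        field_simp
  have hlim : Tendsto (fun T : ℕ => Real.sqrt (K ^ 2 * C * (T : ℝ)⁻¹)) atTop (𝓝 0) := by
    have : Tendsto (fun T : ℕ => K ^ 2 * C * (T : ℝ)⁻¹) atTop (𝓝 (K ^ 2 * C * 0)) :=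
      tendsto_const_nhds.mul tendsto_inv_atTop_nhds_zero_nat
    simpa using this.sqrt
  refine tendsto_of_tendsto_of_tendsto_of_le_of_le' tendsto_const_nhds hlim
    (Eventually.of_forall fun T => integral_nonneg fun ω => abs_nonneg _) ?_
  filter_upwards [eventually_gt_atTop 0] with T hT
  apply Real.le_sqrt_of_sq_le
  refine le_trans ?_ (hZ2 T hT)
  have hv := variance_eq_sub (hZ T).abs
  have hv0 := variance_nonneg (|Z T|) P
  rw [hv] at hv0
  simp only [Pi.pow_apply, Pi.abs_apply, sq_abs] at hv0
  linarith

lemma eta_props {d : ℕ} {Ω' : Type*} {mΩ : MeasurableSpace Ω'} (P : Measure Ω')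
    [IsProbabilityMeasure P] (F : Filtration ℕ mΩ) (ε : ℕ → Ω' → Fin d → ℝ)
    (hmeas : ∀ t, Measurable (ε t))
    (hadapted : ∀ t, Measurable[F t] (ε t))
    (hcondcov : ∀ t i j,
      P[fun ω => ε (t + 1) ω i * ε (t + 1) ω j|F t]
        =ᵐ[P] fun _ => if i = j then (1 : ℝ) else 0)
    (hmom : ∃ m : ℝ, 1 < m ∧ (∀ t, Integrable (fun ω => euclNorm (ε t ω) ^ (4 * m)) P) ∧
      ∃ C : ℝ, ∀ t, ∫ ω, euclNorm (ε t ω) ^ (4 * m) ∂P ≤ C) (i j : Fin d) :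
    (∀ t, MemLp (fun ω => ε t ω i * ε t ω j - if i = j then (1 : ℝ) else 0) 2 P) ∧
    (∀ s t, 1 ≤ s → s < t → ∫ ω, (ε s ω i * ε s ω j - if i = j then (1 : ℝ) else 0) *
      (ε t ω i * ε t ω j - if i = j then (1 : ℝ) else 0) ∂P = 0) ∧
    ∃ C : ℝ, ∀ t, ∫ ω, (ε t ω i * ε t ω j - if i = j then (1 : ℝ) else 0) ^ 2 ∂P ≤ C := by
  obtain ⟨m, hm, hI, C, hC⟩ := hmom
  set δ : ℝ := if i = j then (1 : ℝ) else 0 with hδ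
  have hδ1 : δ ^ 2 ≤ 1 := by rw [hδ]; split_ifs <;> norm_num
  have hcoord : ∀ t k, Measurable (fun ω => ε t ω k) := fun t k =>
    (measurable_pi_apply k).comp (hmeas t)
  have hprod : ∀ t, Measurable (fun ω => ε t ω i * ε t ω j) := fun t =>
    (hcoord t i).mul (hcoord t j)
  have hbound : ∀ t ω, (ε t ω i * ε t ω j) ^ 2 ≤ 1 + euclNorm (ε t ω) ^ (4 * m) := by
    intro t ω
    set N := euclNorm (ε t ω) with hN
    have hN0 : 0 ≤ N := Real.sqrt_nonneg _
    have hk : ∀ k, ε t ω k ^ 2 ≤ N ^ 2 := by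
      intro k
      rw [hN, euclNorm, Real.sq_sqrt (Finset.sum_nonneg fun _ _ => sq_nonneg _)]
      exact Finset.single_le_sum (f := fun k => ε t ω k ^ 2) (fun _ _ => sq_nonneg _)
        (Finset.mem_univ k)
    have h4 : (ε t ω i * ε t ω j) ^ 2 ≤ N ^ 4 := by
      rw [mul_pow, show N ^ 4 = N ^ 2 * N ^ 2 by ring]
      exact mul_le_mul (hk i) (hk j) (sq_nonneg _) (sq_nonneg _)
    refine h4.trans ?_
    rcases le_total N 1 with h | h
    · have : N ^ 4 ≤ 1 := pow_le_one₀ hN0 h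
      have := Real.rpow_nonneg hN0 (4 * m)
      linarith
    · have : N ^ (4 : ℝ) ≤ N ^ (4 * m) := Real.rpow_le_rpow_of_exponent_le h (by linarith)
      have e : N ^ (4 : ℝ) = N ^ 4 := by
        rw [← Real.rpow_natCast N 4]; norm_num
      rw [e] at this
      exact this.trans (le_add_of_nonneg_left zero_le_one)
  have hintB : ∀ t, Integrable (fun ω => 1 + euclNorm (ε t ω) ^ (4 * m)) P := fun t =>
    (integrable_const 1).add (hI t)
  have hsqI : ∀ t, Integrable (fun ω => (ε t ω i * ε t ω j) ^ 2) P := by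
    intro t
    refine (hintB t).mono' ((hprod t).pow_const 2).aestronglyMeasurable ?_
    refine Eventually.of_forall fun ω => ?_
    rw [Real.norm_of_nonneg (sq_nonneg _)]
    exact hbound t ω
  have hpL : ∀ t, MemLp (fun ω => ε t ω i * ε t ω j) 2 P := fun t =>
    (memLp_two_iff_integrable_sq (hprod t).aestronglyMeasurable).mpr (hsqI t)
  have hL : ∀ t, MemLp (fun ω => ε t ω i * ε t ω j - δ) 2 P := fun t =>
    (hpL t).sub (memLp_const δ)
  refine ⟨hL, ?_, 2 * (1 + C) + 2, ?_⟩
  · intro s t hs hst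
    obtain ⟨u, rfl⟩ : ∃ u, t = u + 1 := ⟨t - 1, by omega⟩
    have hce : P[fun ω => ε (u + 1) ω i * ε (u + 1) ω j - δ|F u] =ᵐ[P] 0 := by
      have h1 := condExp_sub ((hpL (u + 1)).integrable one_le_two)
        (integrable_const (μ := P) δ) (F u)
      rw [condExp_const (F.le u)] at h1
      refine h1.trans ?_
      filter_upwards [hcondcov u i j] with ω hω
      simp only [Pi.sub_apply, Pi.zero_apply]
      rw [hω]
      simp [hδ]
    have hsm : StronglyMeasurable[F u] (fun ω => ε s ω i * ε s ω j - δ) := by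
      have hle : F s ≤ F u := F.mono (by omega)
      have hmk : ∀ k, Measurable[F u] (fun ω => ε s ω k) := fun k =>
        ((measurable_pi_apply k).comp (hadapted s)).mono hle le_rfl
      exact (((hmk i).mul (hmk j)).sub_const δ).stronglyMeasurable
    have hm2 := condExp_mul_of_stronglyMeasurable_left hsm
      ((hL s).integrable_mul (hL (u + 1))) ((hL (u + 1)).integrable one_le_two)
    have := integral_condExp (μ := P) (F.le u) (f := (fun ω => ε s ω i * ε s ω j - δ) *
      (fun ω => ε (u + 1) ω i * ε (u + 1) ω j - δ))
    simp only [Pi.mul_apply] at this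
    rw [← this]
    have hz : P[(fun ω => ε s ω i * ε s ω j - δ) *
      (fun ω => ε (u + 1) ω i * ε (u + 1) ω j - δ)|F u] =ᵐ[P] 0 := by
      filter_upwards [hm2, hce] with ω h1 h2
      rw [h1, Pi.mul_apply, h2]
      simp
    rw [integral_congr_ae hz]
    simp
  · intro t
    have h1 : ∫ ω, (ε t ω i * ε t ω j - δ) ^ 2 ∂P ≤
        ∫ ω, (2 * (1 + euclNorm (ε t ω) ^ (4 * m)) + 2) ∂P := by
      refine integral_mono (hL t).integrable_sq (((hintB t).const_mul 2).add (integrable_const 2)) ?_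
      intro ω
      have := hbound t ω
      simp only
      nlinarith [sq_nonneg (ε t ω i * ε t ω j + δ)]
    rw [integral_add ((hintB t).const_mul 2) (integrable_const 2), integral_const_mul,
      integral_add (integrable_const 1) (hI t)] at h1
    simp at h1
    linarith [hC t]

theorem statement4
    (d₁ d₂ : ℕ) (hd₁ : 1 ≤ d₁) (hd₂ : 1 ≤ d₂)
    (G₁ : ℝ → Matrix (Fin d₁) (Fin (d₁ + d₂)) ℝ)
    (G₂ : ℝ → Matrix (Fin d₂) (Fin (d₁ + d₂)) ℝ)
    (hG₁bdd : ∃ C : ℝ, ∀ r ∈ Set.Ioc (0 : ℝ) 1, ∀ i j, |G₁ r i j| ≤ C)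
    (hG₂bdd : ∃ C : ℝ, ∀ r ∈ Set.Ioc (0 : ℝ) 1, ∀ i j, |G₂ r i j| ≤ C)
    (hG₁lip : ∀ i j, PiecewiseLipschitz fun r => G₁ r i j)
    (hG₂lip : ∀ i j, PiecewiseLipschitz fun r => G₂ r i j)
    {Ω' : Type*} {mΩ : MeasurableSpace Ω'} (P : Measure Ω') [IsProbabilityMeasure P]
    (F : Filtration ℕ mΩ)
    (ε : ℕ → Ω' → Fin (d₁ + d₂) → ℝ)
    (hmeas : ∀ t, Measurable (ε t))
    (hadapted : ∀ t, Measurable[F t] (ε t))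
    (hcondzero : ∀ t, P[ε (t + 1)|F t] =ᵐ[P] 0)
    (hcondcov : ∀ t i j,
      P[fun ω => ε (t + 1) ω i * ε (t + 1) ω j|F t]
        =ᵐ[P] fun _ => if i = j then (1 : ℝ) else 0)
    (hmom : ∃ m : ℝ, 1 < m ∧ (∀ t, Integrable (fun ω => euclNorm (ε t ω) ^ (4 * m)) P) ∧
      ∃ C : ℝ, ∀ t, ∫ ω, euclNorm (ε t ω) ^ (4 * m) ∂P ≤ C) :
    TendstoInMeasure P
      (fun T : ℕ => fun ω => (T : ℝ)⁻¹ • ∑ t ∈ Finset.Icc 1 T, thetaSeq G₁ G₂ ε T t ω)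
      atTop
      (fun _ => fun p : Fin d₂ × Fin d₁ =>
        ∫ r in Set.Ioc (0 : ℝ) 1, (G₁ r * (G₂ r)ᵀ) p.2 p.1) := by

  obtain ⟨C₁, hC₁⟩ := hG₁bdd
  obtain ⟨C₂, hC₂⟩ := hG₂bdd
  choose hL horth Cη hCη using fun i j => eta_props P F ε hmeas hadapted hcondcov hmom i j
  let g : Fin d₂ × Fin d₁ → ℝ → ℝ := fun p r => (G₁ r * (G₂ r)ᵀ) p.2 p.1
  have hgdef : ∀ p r, g p r = ∑ k, G₁ r p.2 k * G₂ r p.1 k := fun p r => by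
    simp [g, Matrix.mul_apply]
  have hgt : ∀ p, Tendsto (fun T : ℕ => (T : ℝ)⁻¹ * ∑ t ∈ Finset.Icc 1 T, g p ((t : ℝ) / T)) atTop
      (𝓝 (∫ r in Set.Ioc (0 : ℝ) 1, g p r)) := by
    intro p
    refine riemann_tendsto (C := ∑ k : Fin (d₁ + d₂), C₁ * C₂) ?_ ?_
    · intro r hr
      rw [hgdef]
      refine (Finset.abs_sum_le_sum_abs _ _).trans (Finset.sum_le_sum fun k _ => ?_)
      rw [abs_mul]
      exact mul_le_mul (hC₁ r hr _ _) (hC₂ r hr _ _) (abs_nonneg _)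
        ((abs_nonneg _).trans (hC₁ r hr p.2 k))
    · have h1 := ae_all_iff.mpr fun k => pl_ae_cont (hG₁lip p.2 k)
      have h2 := ae_all_iff.mpr fun k => pl_ae_cont (hG₂lip p.1 k)
      filter_upwards [h1, h2] with r hr1 hr2
      have : g p = fun r => ∑ k, G₁ r p.2 k * G₂ r p.1 k := funext (hgdef p)
      rw [this]
      exact tendsto_finsetSum _ fun k _ => (hr1 k).mul (hr2 k)
  let w : Fin d₂ × Fin d₁ → Fin (d₁ + d₂) → Fin (d₁ + d₂) → ℕ → ℕ → ℝ :=
    fun p i j T t => G₂ ((t : ℝ) / T) p.1 i * G₁ ((t : ℝ) / T) p.2 j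
  have hwb : ∀ p i j T t, 1 ≤ t → t ≤ T → |w p i j T t| ≤ C₂ * C₁ := by
    intro p i j T t h1 h2
    have hr : (t : ℝ) / T ∈ Set.Ioc (0 : ℝ) 1 := by
      have ht : (0 : ℝ) < t := by exact_mod_cast h1
      have hT : (0 : ℝ) < T := by exact_mod_cast (lt_of_lt_of_le h1 h2)
      refine ⟨div_pos ht hT, ?_⟩
      rw [div_le_one hT]
      exact_mod_cast h2
    simp only [w]
    rw [abs_mul]
    exact mul_le_mul (hC₂ _ hr _ _) (hC₁ _ hr _ _) (abs_nonneg _)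
      ((abs_nonneg _).trans (hC₂ _ hr p.1 i))
  let Z : Fin d₂ × Fin d₁ → Fin (d₁ + d₂) → Fin (d₁ + d₂) → ℕ → Ω' → ℝ :=
    fun p i j T ω => (T : ℝ)⁻¹ * ∑ t ∈ Finset.Icc 1 T,
      w p i j T t * (ε t ω i * ε t ω j - if i = j then (1 : ℝ) else 0)
  have hZt : ∀ p i j, Tendsto (fun T : ℕ => ∫ ω, |Z p i j T ω| ∂P) atTop (𝓝 0) := by
    intro p i j
    exact orth_tendsto P (fun t ω => ε t ω i * ε t ω j - if i = j then (1 : ℝ) else 0) (Cη i j)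
      (C₂ * C₁) (w p i j) (fun t _ => hL i j t) (horth i j) (fun t _ => hCη i j t) (hwb p i j)
  have hZI : ∀ p i j T, Integrable (fun ω => |Z p i j T ω|) P := by
    intro p i j T
    refine Integrable.abs (Integrable.const_mul (integrable_finsetSum _ fun t _ => ?_) _)
    exact ((hL i j t).integrable one_le_two).const_mul _
  let B : Fin d₂ × Fin d₁ → ℕ → ℝ := fun p T =>
    (T : ℝ)⁻¹ * ∑ t ∈ Finset.Icc 1 T, g p ((t : ℝ) / T) - ∫ r in Set.Ioc (0 : ℝ) 1, g p r
  have hBt : ∀ p, Tendsto (fun T => |B p T|) atTop (𝓝 0) := by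
    intro p
    have := ((hgt p).sub_const (∫ r in Set.Ioc (0 : ℝ) 1, g p r)).abs
    simpa [B] using this
  let f : ℕ → Ω' → ℝ := fun T ω => ∑ p, (|B p T| + ∑ i, ∑ j, |Z p i j T ω|)
  have hf0 : ∀ T ω, 0 ≤ f T ω := fun T ω => by simp only [f]; positivity
  have hfI2 : ∀ T p, Integrable (fun ω => ∑ i, ∑ j, |Z p i j T ω|) P := fun T p =>
    integrable_finsetSum _ fun i _ => integrable_finsetSum _ fun j _ => hZI p i j T
  have hfI1 : ∀ T p, Integrable (fun ω => |B p T| + ∑ i, ∑ j, |Z p i j T ω|) P := fun T p =>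
    (integrable_const _).add (hfI2 T p)
  have hfI : ∀ T, Integrable (f T) P := fun T => integrable_finsetSum _ fun p _ => hfI1 T p
  have hfint : ∀ T, ∫ ω, f T ω ∂P = ∑ p, (|B p T| + ∑ i, ∑ j, ∫ ω, |Z p i j T ω| ∂P) := by
    intro T
    simp only [f]
    rw [integral_finsetSum _ fun p _ => hfI1 T p]
    refine Finset.sum_congr rfl fun p _ => ?_
    rw [integral_add (integrable_const _) (hfI2 T p), integral_const,
      integral_finsetSum _ fun i _ => integrable_finsetSum _ fun j _ => hZI p i j T]
    congr 1
    · simp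
    · exact Finset.sum_congr rfl fun i _ => integral_finsetSum _ fun j _ => hZI p i j T
  have hflim : Tendsto (fun T => ∫ ω, f T ω ∂P) atTop (𝓝 0) := by
    simp_rw [hfint]
    have : Tendsto (fun T => ∑ p, (|B p T| + ∑ i, ∑ j, ∫ ω, |Z p i j T ω| ∂P)) atTop
        (𝓝 (∑ p : Fin d₂ × Fin d₁, (0 + ∑ i : Fin (d₁ + d₂), ∑ j : Fin (d₁ + d₂), (0 : ℝ)))) :=
      tendsto_finsetSum _ fun p _ => (hBt p).add
        (tendsto_finsetSum _ fun i _ => tendsto_finsetSum _ fun j _ => hZt p i j)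
    simpa using this
  have hdec : ∀ (T : ℕ) (ω : Ω') (p : Fin d₂ × Fin d₁), ((T : ℝ)⁻¹ • ∑ t ∈ Finset.Icc 1 T, thetaSeq G₁ G₂ ε T t ω) p
      - ∫ r in Set.Ioc (0 : ℝ) 1, g p r = B p T + ∑ i, ∑ j, Z p i j T ω := by
    intro T ω p
    have key : ∀ t : ℕ, thetaSeq G₁ G₂ ε T t ω p = g p ((t : ℝ) / T) + ∑ i, ∑ j,
        w p i j T t * (ε t ω i * ε t ω j - if i = j then (1 : ℝ) else 0) := by
      intro t
      rw [hgdef]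
      simp only [thetaSeq, Matrix.mulVec, dotProduct, w, mul_sub, Finset.sum_sub_distrib,
        Finset.sum_mul_sum, mul_ite, mul_one, mul_zero, Finset.sum_ite_eq, Finset.mem_univ, if_true]
      rw [show ∑ k, G₁ ((t : ℝ) / T) p.2 k * G₂ ((t : ℝ) / T) p.1 k =
        ∑ k, G₂ ((t : ℝ) / T) p.1 k * G₁ ((t : ℝ) / T) p.2 k from
        Finset.sum_congr rfl fun k _ => mul_comm _ _, add_sub_cancel]
      exact Finset.sum_congr rfl fun i _ => Finset.sum_congr rfl fun j _ => by ring
    simp only [Pi.smul_apply, Finset.sum_apply, smul_eq_mul, key, Finset.sum_add_distrib, B, Z,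
      mul_add, ← Finset.mul_sum]
    rw [Finset.sum_comm]
    simp_rw [Finset.sum_comm (s := Finset.Icc 1 T)]
    ring
  rw [tendstoInMeasure_iff_measureReal_norm]
  intro e he
  have hlim2 : Tendsto (fun T => e⁻¹ * ∫ ω, f T ω ∂P) atTop (𝓝 0) := by
    simpa using hflim.const_mul e⁻¹
  refine tendsto_of_tendsto_of_tendsto_of_le_of_le tendsto_const_nhds hlim2
    (fun T => measureReal_nonneg) fun T => ?_
  have hmk := mul_meas_ge_le_integral_of_nonneg (Eventually.of_forall (hf0 T)) (hfI T) e
  have hsub : P.real {x | e ≤ ‖((T : ℝ)⁻¹ • ∑ t ∈ Finset.Icc 1 T, thetaSeq G₁ G₂ ε T t x)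
      - fun p : Fin d₂ × Fin d₁ => ∫ r in Set.Ioc (0 : ℝ) 1, (G₁ r * (G₂ r)ᵀ) p.2 p.1‖}
      ≤ P.real {x | e ≤ f T x} := by
    refine measureReal_mono ?_
    intro ω hω
    refine le_trans (Set.mem_setOf_eq ▸ hω : e ≤ ‖_‖) ?_
    rw [pi_norm_le_iff_of_nonneg (hf0 T ω)]
    intro p
    rw [Pi.sub_apply, Real.norm_eq_abs]
    have := hdec T ω p
    simp only [g] at this
    rw [this]
    calc |B p T + ∑ i, ∑ j, Z p i j T ω| ≤ |B p T| + ∑ i, ∑ j, |Z p i j T ω| := by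
          refine (abs_add_le _ _).trans ?_
          gcongr
          refine (Finset.abs_sum_le_sum_abs _ _).trans (Finset.sum_le_sum fun i _ => ?_)
          exact Finset.abs_sum_le_sum_abs _ _
      _ ≤ f T ω := Finset.single_le_sum
          (f := fun p => |B p T| + ∑ i, ∑ j, |Z p i j T ω|) (fun _ _ => by positivity)
          (Finset.mem_univ p)
  rw [le_inv_mul_iff₀ he]
  exact (mul_le_mul_of_nonneg_left hsub he.le).trans hmk

end
end
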